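/- arXiv:math/0608360 — 3 statements merged into one kernel-verified Lean document; each statement's English description precedes it below -/
import Mathlib

section
/- Riemann-Roch for graphs: Let G be a graph and let D be a divisor on G. Then r(D) − r(K − D) = deg(D) + 1 − g, where K is the canonical divisor and g is the genus of G. -/
open Finset

variable {V : Type}

/-- Degree of a vertex in the multigraph with edge multiplicities `m`. -/
def mdeg [Fintype V] (m : V → V → ℕ) (v : V) : ℕ := ∑ w, m v w

/-- The Laplacian of an integer-valued function on the vertices. -/
def laplacian [Fintype V] (m : V → V → ℕ) (f : V → ℤ) : V → ℤ :=
  fun v => (mdeg m v : ℤ) * f v - ∑ w, (m v w : ℤ) * f w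

/-- Linear equivalence of divisors. -/
def LinEquiv [Fintype V] (m : V → V → ℕ) (D D' : V → ℤ) : Prop :=
  ∃ f : V → ℤ, D - D' = laplacian m f

/-- A divisor is effective if it is nonnegative everywhere. -/
def Effective (D : V → ℤ) : Prop := ∀ v, 0 ≤ D v

/-- Degree of a divisor. -/
def divDeg [Fintype V] (D : V → ℤ) : ℤ := ∑ v, D v

/-- `D` is linearly equivalent to some effective divisor. -/
def Winnable [Fintype V] (m : V → V → ℕ) (D : V → ℤ) : Prop :=
  ∃ E, Effective E ∧ LinEquiv m D E

/-- Number of edges of the multigraph. -/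
def edgeCount [Fintype V] (m : V → V → ℕ) : ℤ := (∑ v, ∑ w, (m v w : ℤ)) / 2

/-- The genus `g = |E| - |V| + 1`. -/
def genus [Fintype V] (m : V → V → ℕ) : ℤ := edgeCount m - Fintype.card V + 1

/-- `m` describes a graph: symmetric, loopless, and connected. -/
def IsGraph [Fintype V] (m : V → V → ℕ) : Prop :=
  (∀ v w, m v w = m w v) ∧ (∀ v, m v v = 0) ∧
  (SimpleGraph.fromRel (fun v w => 0 < m v w)).Connected

/-- The rank `r(D)` of the linear system of a divisor. -/
noncomputable def rankDiv [Fintype V] (m : V → V → ℕ) (D : V → ℤ) : ℤ :=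
  sSup {s : ℤ | s = -1 ∨ (0 ≤ s ∧ ∀ E : V → ℤ, Effective E → divDeg E = s →
    Winnable m (D - E))}

/-- The canonical divisor `K`. -/
def canonical [Fintype V] (m : V → V → ℕ) : V → ℤ := fun v => (mdeg m v : ℤ) - 2

section RRHelpers

lemma rr_lap_eq [Fintype V] (m : V → V → ℕ) (f : V → ℤ) (v : V) :
    laplacian m f v = ∑ w, (m v w : ℤ) * (f v - f w) := by
  simp only [laplacian, mdeg, mul_sub, Finset.sum_sub_distrib, Nat.cast_sum, Finset.sum_mul]

lemma rr_lap_add [Fintype V] (m : V → V → ℕ) (f g : V → ℤ) :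
    laplacian m (f + g) = laplacian m f + laplacian m g := by
  funext v
  simp only [rr_lap_eq, Pi.add_apply, ← Finset.sum_add_distrib]
  exact Finset.sum_congr rfl fun w _ => by ring

lemma rr_lap_smul [Fintype V] (m : V → V → ℕ) (c : ℤ) (f : V → ℤ) :
    laplacian m (fun v => c * f v) = fun v => c * laplacian m f v := by
  funext v
  simp only [rr_lap_eq, Finset.mul_sum]
  exact Finset.sum_congr rfl fun w _ => by ring

lemma rr_lap_neg [Fintype V] (m : V → V → ℕ) (f : V → ℤ) :
    laplacian m (-f) = - laplacian m f := by
  funext v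
  simp only [rr_lap_eq, Pi.neg_apply, ← Finset.sum_neg_distrib]
  exact Finset.sum_congr rfl fun w _ => by ring

lemma rr_deg_lap [Fintype V] (m : V → V → ℕ) (hs : ∀ v w, m v w = m w v) (f : V → ℤ) :
    divDeg (laplacian m f) = 0 := by
  have h1 : divDeg (laplacian m f) = ∑ v, ∑ w, (m v w : ℤ) * (f v - f w) := by
    simp only [divDeg, rr_lap_eq]
  have h2 : divDeg (laplacian m f) = - ∑ v, ∑ w, (m v w : ℤ) * (f v - f w) := by
    rw [h1]
    conv_lhs => rw [Finset.sum_comm]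
    simp only [← Finset.sum_neg_distrib]
    exact Finset.sum_congr rfl fun v _ => Finset.sum_congr rfl fun w _ => by rw [hs w v]; ring
  linarith

lemma rr_deg_sub [Fintype V] (D E : V → ℤ) : divDeg (D - E) = divDeg D - divDeg E := by
  simp [divDeg, Finset.sum_sub_distrib]

lemma rr_win_deg [Fintype V] (m : V → V → ℕ) (hs : ∀ v w, m v w = m w v) (D : V → ℤ)
    (h : Winnable m D) : 0 ≤ divDeg D := by
  obtain ⟨E, hE, f, hf⟩ := h
  have := rr_deg_lap m hs f
  rw [← hf, rr_deg_sub] at this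
  have h2 : 0 ≤ divDeg E := Finset.sum_nonneg fun v _ => hE v
  linarith

/-- the potential with positive Laplacian away from `q` -/
lemma rr_potential [Fintype V] (m : V → V → ℕ) (hm : IsGraph m) (q : V) :
    ∃ h : V → ℤ, ∀ v, v ≠ q → 1 ≤ laplacian m h v := by
  obtain ⟨hs, hl, hc⟩ := hm
  set G := SimpleGraph.fromRel (fun v w => 0 < m v w) with hG
  set M : ℤ := (∑ v, (mdeg m v : ℤ)) + 1 with hM
  set n : ℕ := ∑ v, G.dist v q with hn
  have hdn : ∀ v, G.dist v q ≤ n := fun v =>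
    Finset.single_le_sum (f := fun v => G.dist v q) (fun _ _ => Nat.zero_le _) (Finset.mem_univ v)
  have hdM : ∀ v, (mdeg m v : ℤ) + 1 ≤ M := fun v => by
    have := Finset.single_le_sum (f := fun v => (mdeg m v : ℤ)) (fun _ _ => by positivity)
      (Finset.mem_univ v)
    omega
  have hMpos : 1 ≤ M := by have := hdM q; omega
  refine ⟨fun v => - M ^ (n - G.dist v q), fun v hv => ?_⟩
  obtain ⟨w, hw, hwd⟩ : ∃ w, 0 < m v w ∧ G.dist w q + 1 = G.dist v q := by
    obtain ⟨p, hp⟩ := hc.exists_walk_length_eq_dist v q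
    cases p with
    | nil => exact absurd rfl hv
    | @cons _ w _ hadj p =>
      refine ⟨w, ?_, ?_⟩
      · rw [hG, SimpleGraph.fromRel_adj] at hadj
        rcases hadj.2 with h | h
        · exact h
        · rw [hs]; exact h
      · have h1 := SimpleGraph.dist_le p
        have h2 := (hc.exists_walk_length_eq_dist w q)
        obtain ⟨p2, hp2⟩ := h2
        have h3 := SimpleGraph.dist_le (SimpleGraph.Walk.cons hadj p2)
        simp only [SimpleGraph.Walk.length_cons] at hp h3
        omega
  have hu : ∀ k : ℕ, (1 : ℤ) ≤ M ^ k := fun k => one_le_pow₀ hMpos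
  have e1 : M ^ (n - G.dist w q) = M * M ^ (n - G.dist v q) := by
    rw [← pow_succ']
    congr 1
    have := hdn v
    omega
  have e2 : M ^ (n - G.dist w q) ≤ ∑ w, (m v w : ℤ) * M ^ (n - G.dist w q) := by
    have h1 := Finset.single_le_sum (f := fun w => (m v w : ℤ) * M ^ (n - G.dist w q))
      (fun w _ => mul_nonneg (by positivity) (by have := hu (n - G.dist w q); omega))
      (Finset.mem_univ w)
    have h2 : (1 : ℤ) ≤ m v w := by exact_mod_cast hw
    have := hu (n - G.dist w q)
    nlinarith
  have e3 : laplacian m (fun v => - M ^ (n - G.dist v q)) v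
      = (∑ w, (m v w : ℤ) * M ^ (n - G.dist w q)) - mdeg m v * M ^ (n - G.dist v q) := by
    simp only [laplacian, mul_neg, Finset.sum_neg_distrib]
    ring
  rw [e3]
  have := hdM v
  have := hu (n - G.dist v q)
  nlinarith

/-- existence of reduced divisors -/
lemma rr_reduced [Fintype V] (m : V → V → ℕ) (hm : IsGraph m) (q : V) (D : V → ℤ) :
    ∃ f : V → ℤ, (∀ v, v ≠ q → 0 ≤ D v - laplacian m f v) ∧
      ∀ B : Finset V, q ∈ B → B ≠ Finset.univ →
        ∃ v, v ∉ B ∧ D v - laplacian m f v < ∑ w ∈ B, (m v w : ℤ) := by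
  classical
  obtain ⟨h, hh⟩ := rr_potential m hm q
  set c : ℤ := ∑ v, |D v| with hc
  have hcD : ∀ v, |D v| ≤ c := fun v =>
    Finset.single_le_sum (f := fun v => |D v|) (fun _ _ => abs_nonneg _) (Finset.mem_univ v)
  have hc0 : 0 ≤ c := Finset.sum_nonneg fun _ _ => abs_nonneg _
  let P : ℤ → Prop := fun z => ∃ f : V → ℤ, f q = 0 ∧ (∀ v, v ≠ q → 0 ≤ D v - laplacian m f v)
    ∧ ∑ v, f v = z
  have hne : ∃ z, P z := by
    refine ⟨_, fun v => (-c) * (h v - h q), by simp, fun v hv => ?_, rfl⟩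
    rw [rr_lap_smul m (-c) (fun v => h v - h q)]
    have : laplacian m (fun v => h v - h q) v = laplacian m h v := by
      simp only [rr_lap_eq]
      exact Finset.sum_congr rfl fun w _ => by ring
    simp only [this]
    have h1 := hh v hv
    have h2 := neg_abs_le (D v)
    have h3 := hcD v
    nlinarith
  have hbd : ∃ b, ∀ z, P z → z ≤ b := by
    refine ⟨∑ v, (c + 1) * (h v - h q), ?_⟩
    rintro z ⟨f, hfq, hf, rfl⟩
    refine Finset.sum_le_sum fun v _ => ?_
    set k : V → ℤ := f + (fun v => (-(c + 1)) * h v) with hk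
    have : Nonempty V := ⟨q⟩
    obtain ⟨x, hx⟩ := Finite.exists_max k
    have hxq : x = q := by
      by_contra hne
      have h1 : 0 ≤ laplacian m k x := by
        rw [rr_lap_eq]
        exact Finset.sum_nonneg fun w _ => mul_nonneg (by positivity) (by linarith [hx w])
      rw [hk, rr_lap_add, rr_lap_smul] at h1
      simp only [Pi.add_apply] at h1
      have h2 := hf x hne
      have h3 := hh x hne
      have h4 := le_abs_self (D x)
      have h5 := hcD x
      nlinarith
    have := hx v
    rw [hxq] at this
    simp only [hk, Pi.add_apply, hfq] at this
    linarith
  obtain ⟨z, ⟨f, hfq, hf, hfz⟩, hmax⟩ := Int.exists_greatest_of_bdd hbd hne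
  refine ⟨f, hf, fun B hqB hB => ?_⟩
  by_contra hcon
  push Not at hcon
  set g : V → ℤ := fun v => if v ∈ B then 0 else 1 with hg
  have hP : P (∑ v, (f + g) v) := by
    refine ⟨f + g, by simp [hfq, hg, hqB], fun v hv => ?_, rfl⟩
    rw [rr_lap_add, Pi.add_apply]
    by_cases hvB : v ∈ B
    · have : laplacian m g v ≤ 0 := by
        rw [rr_lap_eq]
        refine Finset.sum_nonpos fun w _ => mul_nonpos_of_nonneg_of_nonpos (by positivity) ?_
        simp only [hg, hvB]
        split_ifs <;> simp
      have := hf v hv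
      linarith
    · have h1 : laplacian m g v = ∑ w ∈ B, (m v w : ℤ) := by
        rw [rr_lap_eq, ← Finset.sum_filter_add_sum_filter_not Finset.univ (fun w => w ∈ B)]
        have a1 : ∑ w ∈ Finset.univ.filter (fun w => w ∈ B), (m v w : ℤ) * (g v - g w)
            = ∑ w ∈ B, (m v w : ℤ) := by
          rw [Finset.filter_mem_eq_inter, Finset.univ_inter]
          exact Finset.sum_congr rfl fun w hw => by simp [hg, hvB, hw]
        have a2 : ∑ w ∈ Finset.univ.filter (fun w => ¬ w ∈ B), (m v w : ℤ) * (g v - g w) = 0 := by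
          refine Finset.sum_eq_zero fun w hw => ?_
          simp at hw
          simp [hg, hvB, hw]
        rw [a1, a2, add_zero]
      have := hcon v hvB
      linarith
  have h1 := hmax _ hP
  have h2 : ∃ v, v ∉ B := by
    by_contra h
    push Not at h
    exact hB (Finset.eq_univ_iff_forall.2 h)
  obtain ⟨v, hv⟩ := h2
  have h3 : 1 ≤ ∑ v, g v := by
    have := Finset.single_le_sum (f := g) (fun w _ => by simp only [hg]; split_ifs <;> simp)
      (Finset.mem_univ v)
    simpa [hg, hv] using this
  simp only [Pi.add_apply, Finset.sum_add_distrib] at h1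
  linarith

/-- the divisor of an ordering -/
def rrNu [Fintype V] (m : V → V → ℕ) (p : V → ℤ) : V → ℤ :=
  fun v => (∑ w, if p w < p v then (m v w : ℤ) else 0) - 1

lemma rr_nu_not_win [Fintype V] [Nonempty V] (m : V → V → ℕ) (p : V → ℤ) :
    ¬ Winnable m (rrNu m p) := by
  classical
  rintro ⟨E, hE, f, hf⟩
  obtain ⟨x, hx⟩ := Finite.exists_max f
  obtain ⟨v, hv, hmin⟩ := Finset.exists_min_image (Finset.univ.filter fun v => f v = f x) p
    ⟨x, by simp⟩
  simp only [Finset.mem_filter, Finset.mem_univ, true_and] at hv hmin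
  have h1 := congrFun hf v
  rw [rr_lap_eq] at h1
  simp only [Pi.sub_apply, rrNu] at h1
  have h2 : (∑ w, if p w < p v then (m v w : ℤ) else 0) ≤ ∑ w, (m v w : ℤ) * (f v - f w) := by
    refine Finset.sum_le_sum fun w _ => ?_
    have hw := hx w
    split_ifs with hlt
    · have : f w ≠ f x := fun h => by have := hmin w h; omega
      have : 1 ≤ f v - f w := by omega
      have h0 : (0 : ℤ) ≤ m v w := by positivity
      nlinarith
    · exact mul_nonneg (by positivity) (by omega)
  have := hE v
  linarith

lemma rr_nu_neg [Fintype V] (m : V → V → ℕ) (hm : IsGraph m) (p : V → ℤ)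
    (hp : Function.Injective p) : canonical m - rrNu m p = rrNu m (-p) := by
  funext v
  have : (mdeg m v : ℤ) = (∑ w, if p w < p v then (m v w : ℤ) else 0)
      + ∑ w, if (-p) w < (-p) v then (m v w : ℤ) else 0 := by
    simp only [mdeg, Nat.cast_sum, ← Finset.sum_add_distrib]
    refine Finset.sum_congr rfl fun w _ => ?_
    simp only [Pi.neg_apply, neg_lt_neg_iff]
    rcases lt_trichotomy (p w) (p v) with h | h | h
    · simp [h, h.le]
    · have := hp h
      subst this
      simp [hm.2.1]
    · simp [h, h.le]
  simp only [Pi.sub_apply, canonical, rrNu]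
  linarith

lemma rr_nu_deg [Fintype V] (m : V → V → ℕ) (hm : IsGraph m) (p : V → ℤ)
    (hp : Function.Injective p) : divDeg (rrNu m p) = genus m - 1 := by
  have h1 : divDeg (rrNu m p)
      = (∑ v, ∑ w, if p w < p v then (m v w : ℤ) else 0) - Fintype.card V := by
    simp [divDeg, rrNu, Finset.sum_sub_distrib]
  have h2 : (∑ v, ∑ w, (m v w : ℤ))
      = 2 * (∑ v, ∑ w, if p w < p v then (m v w : ℤ) else 0) := by
    have h3 : (∑ v, ∑ w, if p w < p v then (m v w : ℤ) else 0)
        = ∑ v, ∑ w, if p v < p w then (m v w : ℤ) else 0 := by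
      rw [Finset.sum_comm]
      exact Finset.sum_congr rfl fun v _ => Finset.sum_congr rfl fun w _ => by rw [hm.1 w v]
    rw [two_mul]
    nth_rewrite 2 [h3]
    simp only [← Finset.sum_add_distrib]
    refine Finset.sum_congr rfl fun v _ => Finset.sum_congr rfl fun w _ => ?_
    rcases lt_trichotomy (p w) (p v) with h | h | h
    · simp [h, h.le]
    · have := hp h
      subst this
      simp [hm.2.1]
    · simp [h, h.le]
  rw [h1, genus, edgeCount, h2]
  omega

lemma rr_deg_canonical [Fintype V] (m : V → V → ℕ) (hm : IsGraph m) (p : V → ℤ)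
    (hp : Function.Injective p) : divDeg (canonical m) = 2 * genus m - 2 := by
  have h1 := rr_nu_deg m hm p hp
  have h2 := rr_nu_deg m hm (-p) (neg_injective.comp hp)
  rw [← rr_nu_neg m hm p hp, rr_deg_sub] at h2
  linarith

/-- Dhar's burning order -/
lemma rr_dhar [Fintype V] (m : V → V → ℕ) (q : V) (D : V → ℤ)
    (hD : ∀ B : Finset V, q ∈ B → B ≠ Finset.univ →
        ∃ v, v ∉ B ∧ D v < ∑ w ∈ B, (m v w : ℤ)) (n : ℕ) :
    ∀ B : Finset V, Fintype.card V ≤ B.card + n → q ∈ B →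
      ∃ p : V → ℤ, (∀ v ∈ B, p v = 0) ∧ (∀ v, v ∉ B → 0 < p v) ∧
        (∀ v w, v ∉ B → w ∉ B → p v = p w → v = w) ∧
        ∀ v, v ∉ B → D v < ∑ w, if p w < p v then (m v w : ℤ) else 0 := by
  classical
  induction n with
  | zero =>
    intro B hB _
    have : B = Finset.univ := by
      rw [← Finset.card_eq_iff_eq_univ]
      exact le_antisymm (Finset.card_le_univ B) (by simpa using hB)
    subst this
    exact ⟨0, by simp⟩
  | succ n ih =>
    intro B hB hq
    by_cases hu : B = Finset.univ
    · subst hu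
      exact ⟨0, by simp⟩
    obtain ⟨v, hvB, hv⟩ := hD B hq hu
    obtain ⟨p, p0, ppos, pinj, pD⟩ := ih (insert v B)
      (by rw [Finset.card_insert_of_notMem hvB]; omega) (by simp [hq])
    simp only [Finset.mem_insert, forall_eq_or_imp, not_or] at p0 ppos pinj pD
    refine ⟨fun w => if w ∈ B then 0 else p w + 1, fun w hw => by simp [hw], fun w hw => ?_, ?_, ?_⟩
    · simp only [hw, if_false]
      by_cases h : w = v
      · subst h; rw [p0.1]; norm_num
      · have := ppos w ⟨h, hw⟩; omega
    · intro x y hx hy hxy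
      simp only [hx, hy, if_false, add_left_inj] at hxy
      by_cases hxv : x = v
      · by_cases hyv : y = v
        · rw [hxv, hyv]
        · have := ppos y ⟨hyv, hy⟩
          rw [hxv] at hxy
          have := p0.1
          omega
      · by_cases hyv : y = v
        · have := ppos x ⟨hxv, hx⟩
          rw [hyv] at hxy
          have := p0.1
          omega
        · exact pinj x y ⟨hxv, hx⟩ ⟨hyv, hy⟩ hxy
    · intro x hx
      by_cases hxv : x = v
      · subst hxv
        refine lt_of_lt_of_le hv ?_
        rw [← Finset.sum_filter]
        refine Finset.sum_le_sum_of_subset_of_nonneg ?_ (fun _ _ _ => by positivity)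
        intro w hw
        simp [hw, hx, p0.1]
      · refine lt_of_lt_of_le (pD x ⟨hxv, hx⟩) (Finset.sum_le_sum fun w _ => ?_)
        have := ppos x ⟨hxv, hx⟩
        by_cases hwB : w ∈ B
        · have h1 : (0 : ℤ) < p x + 1 := by omega
          simp only [hwB, hx, if_true, if_false, h1, p0.2 w hwB, this]
          exact le_rfl
        · simp [hwB, hx]

lemma rr_dichotomy [Fintype V] (m : V → V → ℕ) (hm : IsGraph m) (D : V → ℤ)
    (h : ¬ Winnable m D) :
    ∃ p : V → ℤ, Function.Injective p ∧ Winnable m (rrNu m p - D) := by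
  obtain ⟨q⟩ := hm.2.2.nonempty
  obtain ⟨f, hf, hred⟩ := rr_reduced m hm q D
  obtain ⟨p, p0, ppos, pinj, pD⟩ := rr_dhar m q (fun v => D v - laplacian m f v) hred
    (Fintype.card V) {q} (by simp) (by simp)
  simp only [Finset.mem_singleton, forall_eq] at p0 ppos pinj pD
  refine ⟨p, ?_, ?_⟩
  · intro x y hxy
    by_cases hx : x = q
    · by_cases hy : y = q
      · rw [hx, hy]
      · have := ppos y hy
        rw [hx] at hxy
        omega
    · by_cases hy : y = q
      · have := ppos x hx
        rw [hy] at hxy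
        omega
      · exact pinj x y hx hy hxy
  · refine ⟨rrNu m p - D + laplacian m f, fun v => ?_, -f, ?_⟩
    · simp only [Pi.add_apply, Pi.sub_apply, rrNu]
      by_cases hv : v = q
      · subst hv
        have h1 : D v - laplacian m f v < 0 := by
          by_contra hcon
          push Not at hcon
          refine h ⟨D - laplacian m f, fun w => ?_, f, by abel⟩
          by_cases hw : w = v
          · rw [hw]; exact hcon
          · exact hf w hw
        have h2 : 0 ≤ ∑ w, if p w < p v then (m v w : ℤ) else 0 :=
          Finset.sum_nonneg fun w _ => by split_ifs <;> positivity
        linarith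
      · have := pD v hv
        linarith
    · rw [rr_lap_neg]; abel

lemma rr_rank_bdd [Fintype V] (m : V → V → ℕ) (hm : IsGraph m) (D : V → ℤ) :
    BddAbove {s : ℤ | s = -1 ∨ (0 ≤ s ∧ ∀ E : V → ℤ, Effective E → divDeg E = s →
      Winnable m (D - E))} := by
  classical
  obtain ⟨q⟩ := hm.2.2.nonempty
  refine ⟨max (-1) (divDeg D), ?_⟩
  rintro s (rfl | ⟨h0, hs⟩)
  · exact le_max_left _ _
  · have hd : divDeg (fun v => if v = q then s else 0) = s := by simp [divDeg]
    have := rr_win_deg m hm.1 _ (hs (fun v => if v = q then s else 0)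
      (fun v => by simp only; split_ifs <;> omega) hd)
    rw [rr_deg_sub, hd] at this
    exact le_max_of_le_right (by omega)

lemma rr_ineq [Fintype V] (m : V → V → ℕ) (hm : IsGraph m) (D : V → ℤ) :
    rankDiv m D - (divDeg D + 1 - genus m) ≤ rankDiv m (canonical m - D) := by
  have hmem : rankDiv m D ∈ {s : ℤ | s = -1 ∨ (0 ≤ s ∧ ∀ E : V → ℤ, Effective E →
      divDeg E = s → Winnable m (D - E))} :=
    Int.csSup_mem ⟨-1, Or.inl rfl⟩ (rr_rank_bdd m hm D)
  have : Nonempty V := hm.2.2.nonempty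
  have hle := rr_rank_bdd m hm (canonical m - D)
  by_cases hs : rankDiv m D - (divDeg D + 1 - genus m) < 0
  · have h1 : (-1 : ℤ) ≤ rankDiv m (canonical m - D) := le_csSup hle (Or.inl rfl)
    omega
  push Not at hs
  refine le_csSup hle (Or.inr ⟨hs, fun E hE hdE => ?_⟩)
  by_contra hcon
  obtain ⟨p, hp, F, hF, f, hf⟩ := rr_dichotomy m hm _ hcon
  have hK := rr_nu_neg m hm p hp
  have hdF : divDeg F = rankDiv m D := by
    have h1 := rr_deg_lap m hm.1 f
    rw [← hf] at h1
    simp only [rr_deg_sub] at h1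
    rw [rr_nu_deg m hm p hp, rr_deg_canonical m hm p hp, hdE] at h1
    linarith
  have hF0 : 0 ≤ divDeg F := Finset.sum_nonneg fun v _ => hF v
  rcases hmem with h | ⟨_, h⟩
  · omega
  · obtain ⟨E', hE', g, hg⟩ := h F hF hdF
    refine rr_nu_not_win m (-p) ⟨E' + E, fun v => add_nonneg (hE' v) (hE v), g + -f, ?_⟩
    rw [rr_lap_add, rr_lap_neg, ← hf, ← hg, ← hK]
    abel

end RRHelpers

theorem riemann_roch_for_graphs [Fintype V] (m : V → V → ℕ) (hm : IsGraph m) (D : V → ℤ) :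
    rankDiv m D - rankDiv m (canonical m - D) = divDeg D + 1 - genus m := by
  have h1 := rr_ineq m hm D
  have h2 := rr_ineq m hm (canonical m - D)
  have hK : divDeg (canonical m) = 2 * genus m - 2 := by
    have e := Fintype.equivFin V
    exact rr_deg_canonical m hm (fun v => ((e v : ℕ) : ℤ)) (fun x y h => by
      simp only [Nat.cast_inj] at h
      exact e.injective (Fin.ext h))
  rw [sub_sub_cancel, rr_deg_sub, hK] at h2
  linarith
end

section
/- Riemann-Roch criterion: In the abstract setting (X a nonempty set, ∼ an equivalence relation on Div(X) satisfying (E1) and (E2), g ≥ 0 an integer, K ∈ Div(X) of degree 2g−2), the Riemann-Roch formula r(D) − r(K − D) = deg(D) + 1 − g holds for all D ∈ Div(X) if and only if the following two properties are satisfied: (RR1) for every D ∈ Div(X) there exists ν ∈ N such that ε(D) + ε(ν − D) = 1; and (RR2) for every D ∈ Div(X) with deg(D) = g − 1, ε(D) + ε(K − D) = 0. -/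
variable {X : Type}

/-- Degree of a divisor on the set `X` (an element of the free abelian group on `X`). -/
def adeg (D : X →₀ ℤ) : ℤ := D.sum fun _ a => a

/-- A divisor is effective if all its coefficients are nonnegative. -/
def AEff (D : X →₀ ℤ) : Prop := ∀ x, 0 ≤ D x

/-- `|D| ≠ ∅`: some effective divisor is equivalent to `D`. -/
def AWin (R : (X →₀ ℤ) → (X →₀ ℤ) → Prop) (D : X →₀ ℤ) : Prop := ∃ E, AEff E ∧ R D E

/-- The rank `r(D)` of the linear system of a divisor: the largest `s ≥ -1` such that
`|D - E| ≠ ∅` for every effective divisor `E` of degree `s`. -/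
noncomputable def arank (R : (X →₀ ℤ) → (X →₀ ℤ) → Prop) (D : X →₀ ℤ) : ℤ :=
  sSup {s : ℤ | s = -1 ∨ (0 ≤ s ∧ ∀ E : X →₀ ℤ, AEff E → adeg E = s → AWin R (D - E))}

open Classical in
/-- `ε(D) = 0` if `|D| ≠ ∅` and `ε(D) = 1` if `|D| = ∅`. -/
noncomputable def eps (R : (X →₀ ℤ) → (X →₀ ℤ) → Prop) (D : X →₀ ℤ) : ZMod 2 :=
  if AWin R D then 0 else 1

/-- The set `𝒩` of divisors of degree `g - 1` with empty linear system. -/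
def NSet (R : (X →₀ ℤ) → (X →₀ ℤ) → Prop) (g : ℕ) : Set (X →₀ ℤ) :=
  {D | adeg D = (g : ℤ) - 1 ∧ ¬ AWin R D}

theorem adeg_add (D E : X →₀ ℤ) : adeg (D + E) = adeg D + adeg E := by
  unfold adeg
  exact Finsupp.sum_add_index' (fun _ => rfl) (fun _ _ _ => rfl)

theorem adeg_single (x : X) (n : ℤ) : adeg (Finsupp.single x n) = n := by
  unfold adeg
  exact Finsupp.sum_single_index rfl

theorem adeg_sub (D E : X →₀ ℤ) : adeg (D - E) = adeg D - adeg E := by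
  have h := adeg_add (D - E) E
  rw [sub_add_cancel] at h
  linarith

theorem adeg_nonneg {E : X →₀ ℤ} (h : AEff E) : 0 ≤ adeg E :=
  Finset.sum_nonneg fun x _ => h x

theorem aeff_add {D E : X →₀ ℤ} (h : AEff D) (h' : AEff E) : AEff (D + E) := fun x => by
  have := h x
  have := h' x
  rw [Finsupp.add_apply]
  linarith

theorem aeff_single (x : X) {n : ℤ} (h : 0 ≤ n) : AEff (Finsupp.single x n) := fun y => by
  classical
  rw [Finsupp.single_apply]
  split_ifs <;> simp [h]

theorem aeff_zero_of_deg {E : X →₀ ℤ} (h : AEff E) (h0 : adeg E = 0) : E = 0 := by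
  have h1 := (Finset.sum_eq_zero_iff_of_nonneg (fun x _ => h x)).1 h0
  ext x
  by_cases hx : x ∈ E.support
  · exact h1 x hx
  · simpa using hx

section
variable {R : (X →₀ ℤ) → (X →₀ ℤ) → Prop} (hequiv : Equivalence R)
    (hE1 : ∀ D D', R D D' → adeg D = adeg D')
    (hE2 : ∀ D₁ D₁' D₂ D₂', R D₁ D₁' → R D₂ D₂' → R (D₁ + D₂) (D₁' + D₂'))

theorem awin_add (hequiv : Equivalence R)
    (hE2 : ∀ D₁ D₁' D₂ D₂', R D₁ D₁' → R D₂ D₂' → R (D₁ + D₂) (D₁' + D₂'))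
    {D E : X →₀ ℤ} (h : AWin R D) (hE : AEff E) : AWin R (D + E) := by
  obtain ⟨F, hF, hR⟩ := h
  exact ⟨F + E, aeff_add hF hE, hE2 _ _ _ _ hR (hequiv.refl _)⟩

theorem awin_deg (hE1 : ∀ D D', R D D' → adeg D = adeg D')
    {D : X →₀ ℤ} (h : AWin R D) : 0 ≤ adeg D := by
  obtain ⟨F, hF, hR⟩ := h
  rw [hE1 _ _ hR]
  exact adeg_nonneg hF

theorem arank_bdd [Nonempty X] (hE1 : ∀ D D', R D D' → adeg D = adeg D') (D : X →₀ ℤ) :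
    BddAbove {s : ℤ | s = -1 ∨ (0 ≤ s ∧ ∀ E : X →₀ ℤ, AEff E → adeg E = s → AWin R (D - E))} := by
  refine ⟨max (-1) (adeg D), ?_⟩
  rintro s (rfl | ⟨hs, h⟩)
  · exact le_max_left _ _
  · obtain ⟨x⟩ := ‹Nonempty X›
    have h1 := awin_deg hE1 (h _ (aeff_single x hs) (adeg_single x s))
    rw [adeg_sub, adeg_single] at h1
    exact le_max_of_le_right (by linarith)

theorem arank_ge [Nonempty X] (hE1 : ∀ D D', R D D' → adeg D = adeg D') (D : X →₀ ℤ) :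
    -1 ≤ arank R D := le_csSup (arank_bdd hE1 D) (Or.inl rfl)

theorem arank_exists [Nonempty X] (hE1 : ∀ D D', R D D' → adeg D = adeg D') (D : X →₀ ℤ) :
    ∃ E, AEff E ∧ adeg E = arank R D + 1 ∧ ¬ AWin R (D - E) := by
  by_contra! hc
  have h := arank_ge hE1 D
  have : arank R D + 1 ≤ arank R D := by
    conv_rhs => unfold arank
    exact le_csSup (arank_bdd hE1 D) (Or.inr ⟨by linarith, hc⟩)
  linarith

theorem arank_lt [Nonempty X] (hequiv : Equivalence R)
    (hE1 : ∀ D D', R D D' → adeg D = adeg D')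
    (hE2 : ∀ D₁ D₁' D₂ D₂', R D₁ D₁' → R D₂ D₂' → R (D₁ + D₂) (D₁' + D₂'))
    {D E : X →₀ ℤ} (hE : AEff E) (h : ¬ AWin R (D - E)) : arank R D ≤ adeg E - 1 := by
  have h0 := adeg_nonneg hE
  refine csSup_le ⟨-1, Or.inl rfl⟩ ?_
  rintro s (rfl | ⟨hs, hw⟩)
  · linarith
  · by_contra hc
    obtain ⟨x⟩ := ‹Nonempty X›
    have hx : AEff (Finsupp.single x (s - adeg E)) := aeff_single x (by omega)
    have h1 := hw (E + Finsupp.single x (s - adeg E)) (aeff_add hE hx)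
      (by rw [adeg_add, adeg_single]; ring)
    apply h
    have h2 := awin_add hequiv hE2 h1 hx
    convert h2 using 1
    abel

theorem awin_iff [Nonempty X] (hequiv : Equivalence R)
    (hE1 : ∀ D D', R D D' → adeg D = adeg D')
    (hE2 : ∀ D₁ D₁' D₂ D₂', R D₁ D₁' → R D₂ D₂' → R (D₁ + D₂) (D₁' + D₂'))
    (D : X →₀ ℤ) : ¬ AWin R D ↔ arank R D = -1 := by
  constructor
  · intro h
    have h1 := arank_ge hE1 (R := R) D
    have h2 := arank_lt hequiv hE1 hE2 (D := D) (E := 0) (fun _ => le_rfl) (by simpa using h)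
    have h3 : adeg (0 : X →₀ ℤ) = 0 := rfl
    omega
  · intro h
    obtain ⟨E, hE, hd, hw⟩ := arank_exists hE1 (R := R) D
    rw [aeff_zero_of_deg hE (by omega)] at hw
    simpa using hw

theorem awin_congr (hequiv : Equivalence R) {D D' : X →₀ ℤ} (h : R D D') (hw : AWin R D') :
    AWin R D := by
  obtain ⟨E, hE, hR⟩ := hw
  exact ⟨E, hE, hequiv.trans h hR⟩

theorem eps_one (D D' : X →₀ ℤ) : eps R D + eps R D' = 1 ↔ (AWin R D ↔ ¬ AWin R D') := by
  unfold eps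
  by_cases h : AWin R D <;> by_cases h' : AWin R D' <;> simp [h, h'] <;> decide

theorem eps_zero (D D' : X →₀ ℤ) : eps R D + eps R D' = 0 ↔ (AWin R D ↔ AWin R D') := by
  unfold eps
  by_cases h : AWin R D <;> by_cases h' : AWin R D' <;> simp [h, h'] <;> decide

end

theorem riemann_roch_criterion [Nonempty X] (R : (X →₀ ℤ) → (X →₀ ℤ) → Prop)
    (hequiv : Equivalence R)
    (hE1 : ∀ D D', R D D' → adeg D = adeg D')
    (hE2 : ∀ D₁ D₁' D₂ D₂', R D₁ D₁' → R D₂ D₂' → R (D₁ + D₂) (D₁' + D₂'))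
    (g : ℕ) (K : X →₀ ℤ) (hK : adeg K = 2 * (g : ℤ) - 2) :
    (∀ D, arank R D - arank R (K - D) = adeg D + 1 - g) ↔
      ((∀ D, ∃ ν ∈ NSet R g, eps R D + eps R (ν - D) = 1) ∧
       (∀ D, adeg D = (g : ℤ) - 1 → eps R D + eps R (K - D) = 0)) := by
  have hwin := awin_iff hequiv hE1 hE2
  simp only [eps_one, eps_zero]
  constructor
  · intro hRR
    have hRR2 : ∀ D, adeg D = (g : ℤ) - 1 → (AWin R D ↔ AWin R (K - D)) := by
      intro D hD
      have := hRR D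
      rw [← not_iff_not, hwin, hwin]
      constructor <;> intro <;> omega
    have key : ∀ D, ¬ AWin R D → ∃ ν ∈ NSet R g, AWin R (ν - D) := by
      intro D hD
      have h1 := hRR D
      rw [(hwin D).1 hD] at h1
      obtain ⟨E, hE, hd, hw⟩ := arank_exists hE1 (R := R) (K - D)
      have hdeg : adeg (D + E) = (g : ℤ) - 1 := by rw [adeg_add]; omega
      refine ⟨D + E, ⟨hdeg, ?_⟩, E, hE, ?_⟩
      · rw [hRR2 _ hdeg]
        rwa [← sub_sub]
      · rw [add_sub_cancel_left]
        exact hequiv.refl _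
    refine ⟨fun D => ?_, hRR2⟩
    by_cases hD : AWin R D
    · obtain ⟨x⟩ := ‹Nonempty X›
      obtain ⟨ν, hν, -⟩ := key (Finsupp.single x (-1)) (fun h => by
        have := awin_deg hE1 h
        rw [adeg_single] at this
        omega)
      refine ⟨ν, hν, fun _ h => hν.2 ?_, fun _ => hD⟩
      obtain ⟨F, hF, hR⟩ := hD
      have h2 := awin_add hequiv hE2 h hF
      refine awin_congr hequiv ?_ h2
      have h3 := hE2 _ _ _ _ (hequiv.refl (ν - D)) hR
      rwa [sub_add_cancel] at h3
    · obtain ⟨ν, hν, h⟩ := key D hD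
      exact ⟨ν, hν, fun h' => absurd h' hD, fun h' => absurd h h'⟩
  · rintro ⟨h1, h2⟩
    have key : ∀ D, arank R (K - D) ≤ (g : ℤ) - 1 - adeg D + arank R D := by
      intro D
      obtain ⟨E, hE, hd, hw⟩ := arank_exists hE1 (R := R) D
      obtain ⟨ν, hν, h⟩ := h1 (D - E)
      have hw' : AWin R (ν - (D - E)) := by tauto
      obtain ⟨E', hE', hR⟩ := hw'
      have hdeg := hE1 _ _ hR
      rw [adeg_sub, adeg_sub, hν.1] at hdeg
      have h3 : ¬ AWin R (K - D - E') := by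
        intro hc
        have h4 : AWin R (K - ν - E) := by
          refine awin_congr hequiv ?_ hc
          have h5 := hE2 _ _ _ _ (hequiv.symm hR) (hequiv.refl (K - ν - E - E'))
          have h6 := hE2 _ _ _ _ (hequiv.symm hR) (hequiv.refl (K - D - E' - (ν - (D - E))))
          convert h6 using 1 <;> abel
        have h5 := awin_add hequiv hE2 h4 hE
        rw [sub_add_cancel, ← h2 _ hν.1] at h5
        exact hν.2 h5
      have := arank_lt hequiv hE1 hE2 hE' h3
      omega
    intro D
    have a := key D
    have b := key (K - D)
    rw [sub_sub_cancel, adeg_sub] at b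
    omega
end

section
/- For every linear (total) order <_P on the vertex set of a graph G, the divisor ν_P has degree g − 1 and is not linearly equivalent to any effective divisor (i.e., ν_P ∈ N). -/
open Finset

variable {V : Type}

open Classical in
/-- The divisor `ν_P` associated to a (strict) linear order `r` on the vertices:
`ν_P(v) = (number of edges from `v` to vertices preceding `v`) - 1`. -/
noncomputable def nuP [Fintype V] (m : V → V → ℕ) (r : V → V → Prop) : V → ℤ :=
  fun v => (∑ w, if r w v then (m v w : ℤ) else 0) - 1

theorem nuP_mem_N [Fintype V] (m : V → V → ℕ) (hm : IsGraph m)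
    (r : V → V → Prop) (hr : IsStrictTotalOrder V r) :
    divDeg (nuP m r) = genus m - 1 ∧ ¬ Winnable m (nuP m r) := by
  classical
  obtain ⟨hs, hl, hc⟩ := hm
  haveI := hc.nonempty
  constructor
  · have h2 : (∑ v, ∑ w, (m v w : ℤ)) = 2 * ∑ v, ∑ w, (if r w v then (m v w : ℤ) else 0) := by
      have hsw : ∑ v, ∑ w, (if r w v then (m v w : ℤ) else 0)
          = ∑ v, ∑ w, (if r v w then (m v w : ℤ) else 0) := by
        rw [Finset.sum_comm]
        refine Finset.sum_congr rfl fun v _ => Finset.sum_congr rfl fun w _ => ?_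
        rw [hs]
      rw [two_mul]
      nth_rewrite 2 [hsw]
      rw [← Finset.sum_add_distrib]
      refine Finset.sum_congr rfl fun v _ => ?_
      rw [← Finset.sum_add_distrib]
      refine Finset.sum_congr rfl fun w _ => ?_
      rcases trichotomous_of r v w with h | h | h
      · have h' : ¬ r w v := fun h' => asymm_of r h h'
        simp [h, h']
      · subst h
        simp [hl]
      · have h' : ¬ r v w := fun h' => asymm_of r h h'
        simp [h, h']
    simp only [divDeg, nuP, genus, edgeCount, Finset.sum_sub_distrib]
    rw [h2, Int.mul_ediv_cancel_left _ (by norm_num)]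
    simp
  · rintro ⟨E, hE, f, hf⟩
    obtain ⟨x, hx⟩ := Finite.exists_max f
    have wf : WellFounded r := Finite.wellFounded_of_trans_of_irrefl r
    obtain ⟨v, hv, hmin⟩ := wf.has_min {v | ∀ w, f w ≤ f v} ⟨x, hx⟩
    have h1 := congrFun hf v
    have h0 := hE v
    have hlap : laplacian m f v = ∑ w, (m v w : ℤ) * (f v - f w) := by
      simp only [laplacian, mdeg, mul_sub, Finset.sum_sub_distrib, Finset.sum_mul, Nat.cast_sum]
    have hle : (∑ w, if r w v then (m v w : ℤ) else 0) ≤ ∑ w, (m v w : ℤ) * (f v - f w) := by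
      refine Finset.sum_le_sum fun w _ => ?_
      have hw := hv w
      split_ifs with h
      · have hlt : f w < f v := by
          by_contra hn
          exact hmin w (fun u => (hv u).trans (not_lt.mp hn)) h
        have : (1 : ℤ) ≤ f v - f w := by omega
        exact le_mul_of_one_le_right (by positivity) this
      · exact mul_nonneg (by positivity) (by omega)
    simp only [Pi.sub_apply, nuP] at h1
    rw [hlap] at h1
    linarith
end
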